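/- arXiv:2509.16714 — 2 statements merged into one kernel-verified Lean document; each statement's English description precedes it below -/
import Mathlib

section
/- There exist an integer k_0 ≥ 1 and constants M_2 > 0 and M_3 > 0, independent of k, such that for every integer k ≥ k_0 the two nonreal roots of P_N^k are a conjugate pair p^k + i q^k and p^k − i q^k with q^k > 0 satisfying |p^k + (Σ_{j=1}^N b_j)/(2D)| ≤ M_2/k² and |q^k − (2k−1)·√D| ≤ M_3/(2k−1). -/
open Polynomial Complex

/-- The polynomial `(X² + mD) ∏ (X + r j) - m ∑ b i ∏_{j ≠ i} (X + r j)`. -/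
noncomputable def scaledPoly {ι : Type*} [Fintype ι] [DecidableEq ι] (r b : ι → ℝ) (D m : ℝ) :
    Polynomial ℝ :=
  (X ^ 2 + C (m * D)) * ∏ j, (X + C (r j)) -
    C m * ∑ i, C (b i) * ∏ j ∈ Finset.univ.erase i, (X + C (r j))

section General

variable {ι : Type*} [Fintype ι] [DecidableEq ι] (r b : ι → ℝ) (D m : ℝ)

lemma sum_mul_prod_erase_eq {K : Type*} [Field K] (β w : ι → K) (hw : ∀ i, w i ≠ 0) :
    ∑ i, β i * ∏ j ∈ Finset.univ.erase i, w j = (∏ j, w j) * ∑ i, β i / w i := by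
  rw [Finset.mul_sum]
  refine Finset.sum_congr rfl fun i _ => ?_
  rw [← Finset.mul_prod_erase Finset.univ w (Finset.mem_univ i)]
  field_simp [hw i]

lemma scaledPoly_eval (y : ℝ) :
    (scaledPoly r b D m).eval y = (y ^ 2 + m * D) * ∏ j, (y + r j) -
      m * ∑ i, b i * ∏ j ∈ Finset.univ.erase i, (y + r j) := by
  simp [scaledPoly, eval_prod, eval_finsetSum]

lemma scaledPoly_eval_eq_mul (y : ℝ) (hy : ∀ i, y + r i ≠ 0) :
    (scaledPoly r b D m).eval y =
      (∏ j, (y + r j)) * (y ^ 2 + m * D - m * ∑ i, b i / (y + r i)) := by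
  rw [scaledPoly_eval, sum_mul_prod_erase_eq b (fun j => y + r j) hy]
  ring

lemma scaledPoly_map_eval (z : ℂ) :
    ((scaledPoly r b D m).map (algebraMap ℝ ℂ)).eval z = (z ^ 2 + m * D) * ∏ j, (z + r j) -
      m * ∑ i, (b i : ℂ) * ∏ j ∈ Finset.univ.erase i, (z + r j) := by
  simp [scaledPoly, eval_prod, eval_finsetSum, Polynomial.map_prod, Polynomial.map_sum]

lemma scaledPoly_map_eval_eq_mul (z : ℂ) (hz : ∀ i, z + r i ≠ 0) :
    ((scaledPoly r b D m).map (algebraMap ℝ ℂ)).eval z =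
      (∏ j, (z + r j)) * (z ^ 2 + m * D - m * ∑ i, b i / (z + r i)) := by
  rw [scaledPoly_map_eval, sum_mul_prod_erase_eq (fun i => (b i : ℂ)) (fun j => z + r j) hz]
  ring

lemma scaledPoly_eval_neg (i : ι) :
    (scaledPoly r b D m).eval (-r i) =
      -(m * (b i * ∏ j ∈ Finset.univ.erase i, (r j - r i))) := by
  have h0 : ∏ j, (-r i + r j) = 0 := Finset.prod_eq_zero (Finset.mem_univ i) (by ring)
  rw [scaledPoly_eval, h0, Finset.sum_eq_single i]
  · have : ∀ j, -r i + r j = r j - r i := fun j => by ring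
    simp [this]
  · intro k _ hk
    rw [Finset.prod_eq_zero (Finset.mem_erase.2 ⟨hk.symm, Finset.mem_univ i⟩) (by ring), mul_zero]
  · simp

lemma scaledPoly_monic_natDegree :
    (scaledPoly r b D m).Monic ∧ (scaledPoly r b D m).natDegree = Fintype.card ι + 2 := by
  have h1 : (X ^ 2 + C (m * D) : ℝ[X]).Monic := monic_X_pow_add_C _ two_ne_zero
  have h2 : (∏ j, (X + C (r j)) : ℝ[X]).Monic := monic_prod_of_monic _ _ fun j _ => monic_X_add_C _
  have hd : ((X ^ 2 + C (m * D)) * ∏ j, (X + C (r j)) : ℝ[X]).natDegree = Fintype.card ι + 2 := by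
    rw [h1.natDegree_mul h2, natDegree_X_pow_add_C,
      natDegree_prod_of_monic _ _ fun j _ => monic_X_add_C _]
    simp [add_comm]
  have hlt : (C m * ∑ i, C (b i) * ∏ j ∈ Finset.univ.erase i, (X + C (r j)) : ℝ[X]).natDegree <
      Fintype.card ι + 2 := by
    refine lt_of_le_of_lt (natDegree_C_mul_le _ _) ?_
    refine lt_of_le_of_lt (natDegree_sum_le_of_forall_le (n := Fintype.card ι) _ _ ?_) (by omega)
    intro i _
    refine (natDegree_C_mul_le _ _).trans ?_
    rw [natDegree_prod_of_monic _ _ fun j _ => monic_X_add_C _]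
    simp
  have hdeg := hd ▸ hlt
  refine ⟨(h1.mul h2).sub_of_left (degree_lt_degree hdeg), ?_⟩
  rw [scaledPoly, natDegree_sub_eq_left_of_natDegree_lt hdeg, hd]

variable {r b D m}

/-- To the right of `T > (∑ b) / D` the scaled polynomial is bounded below by a multiple of `m`. -/
lemma scaledPoly_eval_ge (hr : ∀ i, 0 < r i) (hb : ∀ i, 0 < b i) (hm : 0 < m)
    {T y : ℝ} (hT : 0 < T) (hy : T ≤ y) :
    (∏ j, (y + r j)) * (m * (D - (∑ i, b i) / T)) ≤ (scaledPoly r b D m).eval y := by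
  have hpos : ∀ i, 0 < y + r i := fun i => by linarith [hr i]
  rw [scaledPoly_eval_eq_mul r b D m y fun i => (hpos i).ne']
  refine mul_le_mul_of_nonneg_left ?_ (Finset.prod_nonneg fun i _ => (hpos i).le)
  have hs : ∑ i, b i / (y + r i) ≤ (∑ i, b i) / T := by
    rw [Finset.sum_div]
    refine Finset.sum_le_sum fun i _ => ?_
    exact div_le_div_of_nonneg_left (hb i).le hT (by linarith [hr i])
  nlinarith [mul_le_mul_of_nonneg_left hs hm.le, sq_nonneg y]

lemma neg_le_of_scaledPoly_root (hb : ∀ i, 0 < b i) (hD : 0 < D) (hm : 0 < m)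
    {R y : ℝ} (hR : ∀ i, r i ≤ R) (hy : (scaledPoly r b D m).eval y = 0) : -R ≤ y := by
  by_contra! h
  have hneg : ∀ i, y + r i < 0 := fun i => by linarith [hR i]
  rw [scaledPoly_eval_eq_mul r b D m y fun i => (hneg i).ne] at hy
  have hprod : ∏ j, (y + r j) ≠ 0 := Finset.prod_ne_zero_iff.2 fun i _ => (hneg i).ne
  have h0 := (mul_eq_zero.1 hy).resolve_left hprod
  have hs : ∑ i, b i / (y + r i) ≤ 0 :=
    Finset.sum_nonpos fun i _ => (div_neg_of_pos_of_neg (hb i) (hneg i)).le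
  nlinarith [mul_pos hm hD, sq_nonneg y, mul_nonneg hm.le (neg_nonneg.2 hs)]

lemma lt_of_scaledPoly_root (hr : ∀ i, 0 < r i) (hb : ∀ i, 0 < b i) (hm : 0 < m)
    {T y : ℝ} (hT : 0 < T) (hDT : 0 < D - (∑ i, b i) / T)
    (hy : (scaledPoly r b D m).eval y = 0) : y < T := by
  by_contra! h
  have h1 := scaledPoly_eval_ge (D := D) hr hb hm hT h
  have h2 : 0 < (∏ j, (y + r j)) * (m * (D - (∑ i, b i) / T)) :=
    mul_pos (Finset.prod_pos fun i _ => by linarith [hr i]) (mul_pos hm hDT)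
  linarith

set_option maxHeartbeats 1000000 in
/-- Quantitative consequences of the root equation for a nonreal root far from the origin. -/
lemma root_asymptotics (hr : ∀ i, 0 < r i) (hb : ∀ i, 0 < b i) (hD : 0 < D) (hm : 0 < m)
    {R T κ p q : ℝ} (hR : ∀ i, r i ≤ R) (hT : 0 < T) (hκ : 0 < κ) (hq : 0 < q)
    (hmκ : 4 * (T + R) ^ 2 ≤ m * κ) (hpq : m * κ ≤ (T - p) ^ 2 + q ^ 2)
    (hz : ((scaledPoly r b D m).map (algebraMap ℝ ℂ)).eval ((p : ℂ) + q * I) = 0)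
    {B c E : ℝ} (hB : B = ∑ i, b i) (hc : c = 2 * B / κ)
    (hE : E = c ^ 2 + 4 * B * (c + R) / κ) :
    |q ^ 2 - m * D| ≤ E ∧
      |p + B / (2 * D)| ≤ 2 * B * ((c + R) ^ 2 + E) / (κ * D) / m := by
  have hne : ∀ i, (p : ℂ) + q * I + r i ≠ 0 := fun i h => by
    have := congrArg Complex.im h
    simp at this
    exact hq.ne' this
  rw [scaledPoly_map_eval_eq_mul r b D m _ hne] at hz
  have h0 := (mul_eq_zero.1 hz).resolve_left (Finset.prod_ne_zero_iff.2 fun i _ => hne i)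
  set A : ι → ℝ := fun i => (p + r i) ^ 2 + q ^ 2 with hA
  have hApos : ∀ i, 0 < A i := fun i => by simp only [hA]; positivity
  have hterm : ∀ i, (b i : ℂ) / ((p : ℂ) + q * I + r i) =
      ((b i * (p + r i) / A i : ℝ) : ℂ) - ((b i * q / A i : ℝ) : ℂ) * I := fun i => by
    have hAc : (A i : ℂ) ≠ 0 := by exact_mod_cast (hApos i).ne'
    rw [div_eq_iff (hne i)]
    push_cast
    field_simp
    simp only [hA]
    push_cast
    ring_nf
    simp only [I_sq]
    ring
  simp_rw [hterm] at h0
  rw [Finset.sum_sub_distrib, ← Finset.sum_mul, ← ofReal_sum, ← ofReal_sum] at h0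
  have hre := congrArg Complex.re h0
  have him := congrArg Complex.im h0
  simp [pow_two] at hre him
  have him' : 2 * p = -∑ i, b i * (m / A i) := by
    have h1 : q * (2 * p + ∑ i, b i * (m / A i)) = 0 := by
      have h2 : m * ∑ i, b i * q / A i = q * ∑ i, b i * (m / A i) := by
        rw [Finset.mul_sum, Finset.mul_sum]
        exact Finset.sum_congr rfl fun i _ => by ring
      linarith
    have := (mul_eq_zero.1 h1).resolve_left hq.ne'
    linarith
  have hre' : p ^ 2 - q ^ 2 + m * D = ∑ i, b i * (p + r i) * (m / A i) := by
    have h2 : m * ∑ i, b i * (p + r i) / A i = ∑ i, b i * (p + r i) * (m / A i) := by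
      rw [Finset.mul_sum]
      exact Finset.sum_congr rfl fun i _ => by ring
    linarith
  have hAge : ∀ i, m * κ / 4 ≤ A i := fun i => by
    have h1 : (T + r i) ^ 2 ≤ (T + R) ^ 2 := by
      have := hr i
      have := hR i
      gcongr
    simp only [hA]
    nlinarith [sq_nonneg ((T + r i) + (p + r i)), sq_nonneg q]
  have hmA : ∀ i, m / A i ≤ 4 / κ := fun i => by
    rw [div_le_div_iff₀ (hApos i) hκ]
    linarith [hAge i]
  have hmA0 : ∀ i, 0 < m / A i := fun i => div_pos hm (hApos i)
  have hB0 : 0 ≤ B := hB ▸ Finset.sum_nonneg fun i _ => (hb i).le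
  have hp : |p| ≤ c := by
    have h1 : ∑ i, b i * (m / A i) ≤ B * (4 / κ) := by
      rw [hB, Finset.sum_mul]
      exact Finset.sum_le_sum fun i _ => mul_le_mul_of_nonneg_left (hmA i) (hb i).le
    have h2 : 0 ≤ ∑ i, b i * (m / A i) :=
      Finset.sum_nonneg fun i _ => mul_nonneg (hb i).le (hmA0 i).le
    have h3 : B * (4 / κ) = 2 * c := by rw [hc]; ring
    rw [abs_le]
    constructor <;> linarith
  have hpr : ∀ i, |p + r i| ≤ c + R := fun i => by
    refine (abs_add_le _ _).trans (add_le_add hp ?_)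
    rw [abs_of_pos (hr i)]
    exact hR i
  have hp2 : p ^ 2 ≤ c ^ 2 := sq_le_sq' (abs_le.1 hp).1 (abs_le.1 hp).2
  have hqE : |q ^ 2 - m * D| ≤ E := by
    have h1 : |∑ i, b i * (p + r i) * (m / A i)| ≤ 4 * B * (c + R) / κ := by
      refine (Finset.abs_sum_le_sum_abs _ _).trans ?_
      have : 4 * B * (c + R) / κ = ∑ i, b i * (c + R) * (4 / κ) := by
        rw [← Finset.sum_mul, ← Finset.sum_mul, ← hB]; ring
      rw [this]
      refine Finset.sum_le_sum fun i _ => ?_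
      rw [abs_mul, abs_mul, abs_of_pos (hb i), abs_of_pos (hmA0 i)]
      have h5 : 0 ≤ c + R := (abs_nonneg _).trans (hpr i)
      exact mul_le_mul (mul_le_mul_of_nonneg_left (hpr i) (hb i).le) (hmA i) (hmA0 i).le
        (mul_nonneg (hb i).le h5)
    rw [← hre'] at h1
    rw [abs_le] at h1 ⊢
    constructor <;> nlinarith [sq_nonneg p]
  refine ⟨hqE, ?_⟩
  have hAD : ∀ i, |m / A i - 1 / D| ≤ ((c + R) ^ 2 + E) * (4 / (κ * D * m)) := fun i => by
    have h1 : |m * D - A i| ≤ (c + R) ^ 2 + E := by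
      have h2 : (p + r i) ^ 2 ≤ (c + R) ^ 2 :=
        sq_le_sq' (abs_le.1 (hpr i)).1 (abs_le.1 (hpr i)).2
      rw [abs_le] at hqE ⊢
      simp only [hA]
      constructor <;> nlinarith [sq_nonneg (p + r i), sq_nonneg (c + R)]
    have h3 : m / A i - 1 / D = (m * D - A i) * (1 / (A i * D)) := by
      have := (hApos i).ne'
      field_simp
    have h4 : 1 / (A i * D) ≤ 4 / (κ * D * m) := by
      rw [div_le_div_iff₀ (mul_pos (hApos i) hD) (by positivity)]
      nlinarith [mul_le_mul_of_nonneg_right (hAge i) hD.le]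
    have h5 : 0 < 1 / (A i * D) := one_div_pos.2 (mul_pos (hApos i) hD)
    rw [h3, abs_mul, abs_of_pos h5]
    exact mul_le_mul h1 h4 h5.le ((abs_nonneg _).trans h1)
  have hkey : p + B / (2 * D) = -(1 / 2) * ∑ i, b i * (m / A i - 1 / D) := by
    simp_rw [mul_sub]
    rw [Finset.sum_sub_distrib, ← Finset.sum_mul, ← hB]
    have : p = -(1 / 2) * ∑ i, b i * (m / A i) := by linarith
    rw [mul_sub, ← this]
    field_simp
    ring
  have hsum : |∑ i, b i * (m / A i - 1 / D)| ≤ B * (((c + R) ^ 2 + E) * (4 / (κ * D * m))) := by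
    refine (Finset.abs_sum_le_sum_abs _ _).trans ?_
    rw [hB, Finset.sum_mul]
    refine Finset.sum_le_sum fun i _ => ?_
    rw [abs_mul, abs_of_pos (hb i)]
    exact mul_le_mul_of_nonneg_left (hAD i) (hb i).le
  rw [hkey, abs_mul]
  have h6 : |(-(1 / 2) : ℝ)| = 1 / 2 := by norm_num
  rw [h6]
  refine (mul_le_mul_of_nonneg_left hsum (by norm_num)).trans (le_of_eq ?_)
  field_simp
  ring

/-- If the scaled polynomial has as many distinct real roots as it has poles, the remaining
two roots form a nonreal conjugate pair at distance at least of order `√m`. -/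
lemma exists_nonreal_pair (hr : ∀ i, 0 < r i) (hb : ∀ i, 0 < b i) (hD : 0 < D) (hm : 0 < m)
    {R T κ : ℝ} (hR : ∀ i, r i ≤ R) (hR0 : 0 < R) (hT : 0 < T) (hDT : 0 < D - (∑ i, b i) / T)
    (hκ : κ = (∏ j, (T + r j)) * (D - (∑ i, b i) / T) / (T + R) ^ Fintype.card ι)
    (hmκ : 4 * (T + R) ^ 2 ≤ m * κ) {x : ι → ℝ} (hx : Function.Injective x)
    (hroot : ∀ i, (scaledPoly r b D m).eval (x i) = 0) :
    ∃ p q : ℝ, 0 < q ∧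
      (∀ z : ℂ, (((scaledPoly r b D m).map (algebraMap ℝ ℂ)).eval z = 0 ∧ z.im ≠ 0) ↔
          (z = (p : ℂ) + (q : ℂ) * I ∨ z = (p : ℂ) - (q : ℂ) * I)) ∧
      m * κ ≤ (T - p) ^ 2 + q ^ 2 := by
  obtain ⟨hmon, hdeg⟩ := scaledPoly_monic_natDegree r b D m
  have hQ : (∏ i, (X - C (x i)) : ℝ[X]).Monic := monic_prod_of_monic _ _ fun i _ => monic_X_sub_C _
  obtain ⟨W, hW⟩ : (∏ i, (X - C (x i))) ∣ scaledPoly r b D m :=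
    Fintype.prod_dvd_of_coprime (pairwise_coprime_X_sub_C hx) fun i =>
      dvd_iff_isRoot.2 (hroot i)
  have hWm : W.Monic := hQ.of_mul_monic_left (hW ▸ hmon)
  have hWd : W.natDegree = 2 := by
    have h1 := hQ.natDegree_mul hWm
    rw [← hW, hdeg, natDegree_prod_of_monic _ _ fun i _ => monic_X_sub_C _] at h1
    simp at h1
    omega
  obtain ⟨a, c, hWe⟩ : ∃ a c : ℝ, W = X ^ 2 + C a * X + C c :=
    ⟨W.coeff 1, W.coeff 0, by
      conv_lhs => rw [hWm.as_sum, hWd]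
      simp [Finset.sum_range_succ]
      ring⟩
  have hev : ∀ y : ℝ, (scaledPoly r b D m).eval y = (∏ i, (y - x i)) * (y ^ 2 + a * y + c) :=
    fun y => by rw [hW, hWe]; simp [eval_prod]
  have hevc : ∀ z : ℂ, ((scaledPoly r b D m).map (algebraMap ℝ ℂ)).eval z =
      (∏ i, (z - x i)) * (z ^ 2 + a * z + c) :=
    fun z => by rw [hW, hWe]; simp [eval_prod, Polynomial.map_prod]
  have hlt : ∀ {y : ℝ}, (scaledPoly r b D m).eval y = 0 → y < T :=
    lt_of_scaledPoly_root hr hb hm hT hDT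
  have hge : ∀ {y : ℝ}, (scaledPoly r b D m).eval y = 0 → -R ≤ y :=
    neg_le_of_scaledPoly_root hb hD hm hR
  have hTR : 0 < T + R := by positivity
  have hWT : m * κ ≤ T ^ 2 + a * T + c := by
    have h1 := scaledPoly_eval_ge (D := D) hr hb hm hT le_rfl
    rw [hev] at h1
    have hQpos : 0 < ∏ i, (T - x i) := Finset.prod_pos fun i _ => sub_pos.2 (hlt (hroot i))
    have hQle : ∏ i, (T - x i) ≤ (T + R) ^ Fintype.card ι := by
      have := Finset.prod_le_prod (s := Finset.univ) (f := fun i => T - x i)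
        (g := fun _ => T + R) (fun i _ => (sub_pos.2 (hlt (hroot i))).le)
        (fun i _ => by linarith [hge (hroot i)])
      simpa using this
    have hlow : 0 < (∏ j, (T + r j)) * (m * (D - (∑ i, b i) / T)) :=
      mul_pos (Finset.prod_pos fun i _ => by linarith [hr i]) (mul_pos hm hDT)
    have hpos : 0 < T ^ 2 + a * T + c := (mul_pos_iff_of_pos_left hQpos).1 (hlow.trans_le h1)
    have h2 : (∏ j, (T + r j)) * (m * (D - (∑ i, b i) / T)) ≤
        (T + R) ^ Fintype.card ι * (T ^ 2 + a * T + c) :=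
      h1.trans (mul_le_mul_of_nonneg_right hQle hpos.le)
    rw [hκ, mul_div_assoc', div_le_iff₀ (by positivity)]
    linarith
  have hdisc : a ^ 2 - 4 * c < 0 := by
    by_contra! h
    have hs := Real.sq_sqrt h
    set s := √(a ^ 2 - 4 * c)
    have e1 : (scaledPoly r b D m).eval ((-a + s) / 2) = 0 := by
      rw [hev]
      exact mul_eq_zero_of_right _ (by linarith)
    have e2 : (scaledPoly r b D m).eval ((-a - s) / 2) = 0 := by
      rw [hev]
      exact mul_eq_zero_of_right _ (by linarith)
    have hprod : (T - (-a + s) / 2) * (T - (-a - s) / 2) = T ^ 2 + a * T + c := by linarith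
    have hle : (T - (-a + s) / 2) * (T - (-a - s) / 2) ≤ (T + R) * (T + R) :=
      mul_le_mul (by linarith [hge e1]) (by linarith [hge e2]) (sub_pos.2 (hlt e2)).le hTR.le
    nlinarith [mul_pos hTR hTR]
  have hq2 : 0 < c - a ^ 2 / 4 := by linarith
  refine ⟨-a / 2, √(c - a ^ 2 / 4), Real.sqrt_pos.2 hq2, fun z => ?_, ?_⟩
  · have hs : ((√(c - a ^ 2 / 4) : ℝ) : ℂ) ^ 2 = c - a ^ 2 / 4 := by
      rw [← ofReal_pow, Real.sq_sqrt hq2.le]; push_cast; ring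
    have hspos := Real.sqrt_pos.2 hq2
    set q := √(c - a ^ 2 / 4)
    have hfac : z ^ 2 + a * z + c =
        (z - (((-a / 2 : ℝ) : ℂ) + q * I)) * (z - (((-a / 2 : ℝ) : ℂ) - q * I)) := by
      push_cast
      linear_combination (q : ℂ) ^ 2 * I_sq - hs
    rw [hevc]
    constructor
    · rintro ⟨h1, h2⟩
      have hne : ∏ i, (z - (x i : ℂ)) ≠ 0 := Finset.prod_ne_zero_iff.2 fun i _ h => h2 (by
        have := congrArg Complex.im h
        simpa using this)
      have h3 := (mul_eq_zero.1 h1).resolve_left hne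
      rw [hfac, mul_eq_zero, sub_eq_zero, sub_eq_zero] at h3
      exact h3
    · intro h
      refine ⟨mul_eq_zero_of_right _ ?_, ?_⟩
      · rw [hfac, mul_eq_zero, sub_eq_zero, sub_eq_zero]
        exact h
      · rcases h with rfl | rfl <;> simp [hspos.ne']
  · rw [Real.sq_sqrt hq2.le]
    linarith

end General

lemma prod_erase_sub_mul_prod_erase_sub_neg {N : ℕ} {r : Fin N → ℝ} (hrm : StrictMono r)
    {i j : Fin N} (hij : (j : ℕ) + 1 = i) :
    (∏ k ∈ Finset.univ.erase i, (r k - r i)) * ∏ k ∈ Finset.univ.erase j, (r k - r j) < 0 := by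
  have hlt : j < i := Fin.lt_def.2 (by omega)
  have hji : j ∈ Finset.univ.erase i := by simp [hlt.ne]
  have hij' : i ∈ Finset.univ.erase j := by simp [hlt.ne']
  rw [← Finset.mul_prod_erase _ _ hji, ← Finset.mul_prod_erase _ _ hij',
    Finset.erase_right_comm (a := j), mul_mul_mul_comm, ← Finset.prod_mul_distrib]
  refine mul_neg_of_neg_of_pos ?_ (Finset.prod_pos fun k hk => ?_)
  · nlinarith [hrm hlt]
  · simp only [Finset.mem_erase, Finset.mem_univ, and_true] at hk
    rcases lt_or_ge k j with h | h
    · exact mul_pos_of_neg_of_neg (sub_neg.2 (hrm (h.trans hlt))) (sub_neg.2 (hrm h))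
    · have h1 : (k : ℕ) ≠ i := fun e => by simp [Fin.ext_iff, e] at hk
      have h2 : (k : ℕ) ≠ j := fun e => by simp [Fin.ext_iff, e] at hk
      have h3 : i < k := Fin.lt_def.2 (by have := Fin.le_def.1 h; omega)
      exact mul_pos (sub_pos.2 (hrm h3)) (sub_pos.2 (hrm (hlt.trans h3)))

lemma exists_root_of_mul_neg (P : ℝ[X]) {u v : ℝ} (huv : u < v) (h : P.eval u * P.eval v < 0) :
    ∃ x ∈ Set.Ioo u v, P.eval x = 0 := by
  rcases mul_neg_iff.1 h with ⟨h1, h2⟩ | ⟨h1, h2⟩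
  · exact intermediate_value_Ioo' huv.le P.continuous.continuousOn ⟨h2, h1⟩
  · exact intermediate_value_Ioo huv.le P.continuous.continuousOn ⟨h1, h2⟩

lemma exists_injective_roots {N : ℕ} {r b : Fin N → ℝ} {D m T : ℝ} (hr : ∀ i, 0 < r i)
    (hrm : StrictMono r) (hb : ∀ i, 0 < b i) (hm : 0 < m) (hT : 0 < T)
    (hDT : 0 < D - (∑ i, b i) / T) :
    ∃ x : Fin N → ℝ, Function.Injective x ∧ ∀ i, (scaledPoly r b D m).eval (x i) = 0 := by
  have key : ∀ i : Fin N, ∃ x : ℝ, (-r i < x ∧ ∀ j, j < i → x < -r j) ∧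
      (scaledPoly r b D m).eval x = 0 := by
    intro i
    by_cases hi : (i : ℕ) = 0
    · have hTpos : 0 < (scaledPoly r b D m).eval T :=
        lt_of_lt_of_le (mul_pos (Finset.prod_pos fun i _ => by linarith [hr i]) (mul_pos hm hDT))
          (scaledPoly_eval_ge hr hb hm hT le_rfl)
      have hneg : (scaledPoly r b D m).eval (-r i) < 0 := by
        rw [scaledPoly_eval_neg, neg_lt_zero]
        refine mul_pos hm (mul_pos (hb i) (Finset.prod_pos fun k hk => sub_pos.2 (hrm ?_)))
        have := Finset.ne_of_mem_erase hk
        rw [Fin.lt_def]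
        have : (k : ℕ) ≠ i := fun e => this (Fin.ext e)
        omega
      obtain ⟨x, hx, h0⟩ := exists_root_of_mul_neg (scaledPoly r b D m)
        (by linarith [hr i] : -r i < T) (mul_neg_of_neg_of_pos hneg hTpos)
      refine ⟨x, ⟨hx.1, fun j hj => ?_⟩, h0⟩
      have := Fin.lt_def.1 hj
      omega
    · obtain ⟨l, hl⟩ : ∃ l : Fin N, (l : ℕ) + 1 = i :=
        ⟨⟨i - 1, by omega⟩, by simp; omega⟩
      have hli : l < i := Fin.lt_def.2 (by omega)
      have hneg : (scaledPoly r b D m).eval (-r i) * (scaledPoly r b D m).eval (-r l) < 0 := by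
        rw [scaledPoly_eval_neg, scaledPoly_eval_neg]
        have h1 := prod_erase_sub_mul_prod_erase_sub_neg hrm hl
        have h2 : 0 < m * b i * (m * b l) := mul_pos (mul_pos hm (hb i)) (mul_pos hm (hb l))
        have := mul_neg_of_pos_of_neg h2 h1
        linarith
      obtain ⟨x, hx, h0⟩ := exists_root_of_mul_neg (scaledPoly r b D m)
        (neg_lt_neg (hrm hli)) hneg
      refine ⟨x, ⟨hx.1, fun j hj => hx.2.trans_le (neg_le_neg (hrm.monotone ?_))⟩, h0⟩
      rw [Fin.le_def]
      have := Fin.lt_def.1 hj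
      omega
  choose x hx h0 using key
  have hanti : StrictAnti x := fun i j hij => ((hx j).2 i hij).trans (hx i).1
  exact ⟨x, hanti.injective, h0⟩

/-- There exist `k₀ ≥ 1` and constants `M₂, M₃ > 0`, independent of `k`,
such that for every `k ≥ k₀` the two nonreal roots of `P_N^k` are a conjugate pair
`p^k ± i q^k` with `q^k > 0` satisfying `|p^k + (∑ b_j)/(2D)| ≤ M₂/k²` and
`|q^k - (2k-1)√D| ≤ M₃/(2k-1)`. -/
theorem stmt_11 (N : ℕ) (hN : 0 < N) (r b : Fin N → ℝ)
    (hr : ∀ i, 0 < r i) (hrm : StrictMono r) (hb : ∀ i, 0 < b i)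
    (D : ℝ) (hD : 0 < D)
    (Pk : ℕ → Polynomial ℝ)
    (hPk : ∀ k : ℕ, Pk k =
      (C D + C (((2 * (k : ℝ) - 1) ^ 2)⁻¹) * X ^ 2) * ∏ j, (X + C (r j)) -
      ∑ i, C (b i) * ∏ j ∈ Finset.univ.erase i, (X + C (r j))) :
    ∃ k₀ : ℕ, 1 ≤ k₀ ∧ ∃ M₂ M₃ : ℝ, 0 < M₂ ∧ 0 < M₃ ∧
      ∀ k : ℕ, k₀ ≤ k → ∃ p q : ℝ, 0 < q ∧
        (∀ z : ℂ, (((Pk k).map (algebraMap ℝ ℂ)).eval z = 0 ∧ z.im ≠ 0) ↔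
          (z = (p : ℂ) + (q : ℂ) * I ∨ z = (p : ℂ) - (q : ℂ) * I)) ∧
        |p + (∑ j, b j) / (2 * D)| ≤ M₂ / (k : ℝ) ^ 2 ∧
        |q - (2 * (k : ℝ) - 1) * Real.sqrt D| ≤ M₃ / (2 * (k : ℝ) - 1) := by
  have : Nonempty (Fin N) := ⟨⟨0, hN⟩⟩
  obtain ⟨B, hB⟩ : ∃ B, B = ∑ i, b i := ⟨_, rfl⟩
  obtain ⟨R, hRdef⟩ : ∃ R, R = ∑ i, r i := ⟨_, rfl⟩
  have hBpos : 0 < B := hB ▸ Finset.sum_pos (fun i _ => hb i) Finset.univ_nonempty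
  have hR0 : 0 < R := hRdef ▸ Finset.sum_pos (fun i _ => hr i) Finset.univ_nonempty
  have hR : ∀ i, r i ≤ R := fun i =>
    hRdef ▸ Finset.single_le_sum (fun j _ => (hr j).le) (Finset.mem_univ i)
  obtain ⟨T, hTdef⟩ : ∃ T, T = B / D + 1 := ⟨_, rfl⟩
  have hT : 0 < T := by rw [hTdef]; positivity
  have hDT : 0 < D - (∑ i, b i) / T := by
    rw [← hB, sub_pos, div_lt_iff₀ hT, hTdef, mul_add, mul_div_cancel₀ _ hD.ne']
    linarith
  obtain ⟨κ, hκ⟩ : ∃ κ, κ = (∏ j, (T + r j)) * (D - (∑ i, b i) / T) /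
      (T + R) ^ Fintype.card (Fin N) := ⟨_, rfl⟩
  have hκ0 : 0 < κ := by
    rw [hκ]
    exact div_pos (mul_pos (Finset.prod_pos fun i _ => by linarith [hr i]) hDT) (by positivity)
  obtain ⟨c, hc⟩ : ∃ c, c = 2 * B / κ := ⟨_, rfl⟩
  obtain ⟨E, hE⟩ : ∃ E, E = c ^ 2 + 4 * B * (c + R) / κ := ⟨_, rfl⟩
  have hc0 : 0 < c := by rw [hc]; positivity
  have hE0 : 0 < E := by rw [hE]; positivity
  obtain ⟨k₁, hk₁⟩ := exists_nat_ge (4 * (T + R) ^ 2 / κ)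
  refine ⟨k₁ + 1, by omega, 2 * B * ((c + R) ^ 2 + E) / (κ * D), E / √D, by positivity,
    by positivity, fun k hk => ?_⟩
  have hk1 : (1 : ℝ) ≤ k := by exact_mod_cast (by omega : 1 ≤ k)
  have hkk : (k₁ : ℝ) ≤ k := by exact_mod_cast (by omega : k₁ ≤ k)
  obtain ⟨n, hn⟩ : ∃ n : ℝ, n = 2 * (k : ℝ) - 1 := ⟨_, rfl⟩
  have hkn : (k : ℝ) ≤ n := by linarith
  have hn0 : 0 < n := by linarith
  have hm : 0 < n ^ 2 := by positivity
  have hmκ : 4 * (T + R) ^ 2 ≤ n ^ 2 * κ := by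
    rw [← div_le_iff₀ hκ0]
    nlinarith
  have hPeq : Pk k = C ((n ^ 2)⁻¹) * scaledPoly r b D (n ^ 2) := by
    have hC : (C ((n ^ 2)⁻¹) * C (n ^ 2) : ℝ[X]) = 1 := by
      rw [← C_mul, inv_mul_cancel₀ hm.ne', C_1]
    rw [hPk, scaledPoly, ← hn, C_mul]
    linear_combination (-(C D * ∏ j, (X + C (r j))) +
      ∑ i, C (b i) * ∏ j ∈ Finset.univ.erase i, (X + C (r j))) * hC
  have hzero : ∀ z : ℂ, ((Pk k).map (algebraMap ℝ ℂ)).eval z = 0 ↔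
      ((scaledPoly r b D (n ^ 2)).map (algebraMap ℝ ℂ)).eval z = 0 := fun z => by
    rw [hPeq]
    simp [hn0.ne']
  obtain ⟨x, hx, hroot⟩ := exists_injective_roots (D := D) hr hrm hb hm hT hDT
  obtain ⟨p, q, hq, hiff, hpq⟩ :=
    exists_nonreal_pair hr hb hD hm hR hR0 hT hDT hκ hmκ hx hroot
  obtain ⟨h1, h2⟩ := root_asymptotics hr hb hD hm hR hT hκ0 hq hmκ hpq
    ((hiff _).2 (Or.inl rfl)).1 hB hc hE
  refine ⟨p, q, hq, fun z => by rw [hzero, hiff], ?_, ?_⟩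
  · rw [← hB]
    refine h2.trans (div_le_div_of_nonneg_left (by positivity) (by positivity) ?_)
    gcongr
  · rw [← hn, le_div_iff₀ hn0, le_div_iff₀ (Real.sqrt_pos.2 hD)]
    have hs := Real.sq_sqrt hD.le
    have hs0 := Real.sqrt_pos.2 hD
    have hfac : q ^ 2 - n ^ 2 * D = (q - n * √D) * (q + n * √D) := by
      linear_combination (-n ^ 2) * (-hs)
    rw [hfac, abs_mul, abs_of_pos (by positivity : 0 < q + n * √D)] at h1
    nlinarith [mul_nonneg (abs_nonneg (q - n * √D)) hq.le]
end

section
/- Set b := min_{1≤i≤N} b_i, B := max_{1≤i≤N} b_i, r := min_{1≤i≤N−1} (r_{i+1} − r_i), μ := min{ b·r^{N−1} / (4D(2r_N)^{N−1} + 4NB(2r_N)^{N−2} + 1), r/4, r_1/4 }, R := 2r_N + NB/D + 1, and δ := r^{N−2}·μ / (2N·R^{N−2}). Let a_1 > a_2 > ⋯ > a_N be the N real roots of P_N. Then: (i) |P_N′(λ)| ≥ D·μ·r^{N−2}/2 for every λ in the union of the intervals [a_j − δ, a_j + δ], 1 ≤ j ≤ N; and (ii) |P_N(λ)| ≥ D·μ·δ·r^{N−2}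 for every λ in [−r_N, a_1 + 1] lying outside the union of the intervals [a_j − δ, a_j + δ], 1 ≤ j ≤ N. -/
open Polynomial

/-- A product all of whose factors are at least `m`, except that one may only be at least
`c ≤ m`. -/
lemma Finset.mul_pow_le_prod_of_exception {ι : Type*} [DecidableEq ι] (S : Finset ι) (f : ι → ℝ)
    (e : ι) {c m : ℝ} (hc : 0 ≤ c) (hcm : c ≤ m) {n : ℕ} (hS : S.card = n + 1)
    (hf : ∀ k ∈ S, k ≠ e → m ≤ f k) (he : e ∈ S → c ≤ f e) :
    c * m ^ n ≤ ∏ k ∈ S, f k := by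
  have hm : 0 ≤ m := hc.trans hcm
  by_cases h : e ∈ S
  · rw [← Finset.mul_prod_erase S f h]
    have h1 : m ^ n ≤ ∏ k ∈ S.erase e, f k := by
      have h2 : (S.erase e).card = n := by rw [Finset.card_erase_of_mem h, hS]; rfl
      rw [← h2, ← Finset.prod_const]
      exact Finset.prod_le_prod (fun _ _ => hm) fun k hk =>
        hf k (Finset.mem_of_mem_erase hk) (Finset.ne_of_mem_erase hk)
    exact mul_le_mul (he h) h1 (by positivity) (hc.trans (he h))
  · calc c * m ^ n ≤ m * m ^ n := by gcongr
      _ = ∏ _k ∈ S, m := by rw [Finset.prod_const, hS]; ring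
      _ ≤ ∏ k ∈ S, f k := Finset.prod_le_prod (fun _ _ => hm) fun k hk =>
        hf k hk fun hke => h (hke ▸ hk)

/-- The polynomial `D ∏ (X + r_j) - ∑ b_i ∏_{j ≠ i} (X + r_j)`. -/
noncomputable def secularPoly {ι : Type*} [Fintype ι] [DecidableEq ι] (D : ℝ) (b r : ι → ℝ) :
    ℝ[X] :=
  C D * ∏ j, (X + C (r j)) - ∑ i, C (b i) * ∏ j ∈ Finset.univ.erase i, (X + C (r j))

section SecularPoly

variable {ι : Type*} [Fintype ι] [DecidableEq ι] {D : ℝ} {b r : ι → ℝ}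

lemma eval_secularPoly (x : ℝ) : (secularPoly D b r).eval x =
    D * ∏ j, (x + r j) - ∑ i, b i * ∏ j ∈ Finset.univ.erase i, (x + r j) := by
  simp [secularPoly, eval_prod, eval_finsetSum]

lemma eval_secularPoly_split (x : ℝ) (i : ι) : (secularPoly D b r).eval x =
    (x + r i) * (D * ∏ j ∈ Finset.univ.erase i, (x + r j) -
      ∑ k ∈ Finset.univ.erase i, b k * ∏ j ∈ (Finset.univ.erase i).erase k, (x + r j)) -
      b i * ∏ j ∈ Finset.univ.erase i, (x + r j) := by
  rw [eval_secularPoly, ← Finset.mul_prod_erase Finset.univ _ (Finset.mem_univ i),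
    ← Finset.add_sum_erase Finset.univ _ (Finset.mem_univ i)]
  have h : ∑ k ∈ Finset.univ.erase i, b k * ∏ j ∈ Finset.univ.erase k, (x + r j) =
      (x + r i) * ∑ k ∈ Finset.univ.erase i,
        b k * ∏ j ∈ (Finset.univ.erase i).erase k, (x + r j) := by
    rw [Finset.mul_sum]
    refine Finset.sum_congr rfl fun k hk => ?_
    have hik : i ∈ Finset.univ.erase k := by
      simpa using (Finset.ne_of_mem_erase hk).symm
    rw [← Finset.mul_prod_erase _ _ hik, Finset.erase_right_comm]
    ring
  rw [h]
  ring

lemma eval_secularPoly_neg (i : ι) : (secularPoly D b r).eval (-r i) =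
    -(b i * ∏ j ∈ Finset.univ.erase i, (r j - r i)) := by
  rw [eval_secularPoly_split _ i]
  have h : ∀ j, -r i + r j = r j - r i := fun j => by ring
  simp [h]

/-- A polynomial of this shape with as many distinct roots as its degree splits over them. -/
lemma secularPoly_eq_prod {a : ι → ℝ} (ha : Function.Injective a)
    (hroot : ∀ j, (secularPoly D b r).eval (a j) = 0) :
    secularPoly D b r = C D * ∏ j, (X - C (a j)) := by
  have hdeg : secularPoly D b r - C D * ∏ j, (X - C (a j)) ∈
      degreeLT ℝ (Finset.univ : Finset ι).card := by
    have hsplit : secularPoly D b r - C D * ∏ j, (X - C (a j)) =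
        D • (∏ j, (X + C (r j)) - ∏ j, (X - C (a j))) -
          ∑ i, b i • ∏ j ∈ Finset.univ.erase i, (X + C (r j)) := by
      simp only [secularPoly, smul_eq_C_mul]
      ring
    have h1 : (∏ j, (X + C (r j))).Monic := monic_prod_of_monic _ _ fun j _ => monic_X_add_C _
    have h2 : (∏ j, (X - C (a j))).Monic := monic_prod_of_monic _ _ fun j _ => monic_X_sub_C _
    have d1 : (∏ j, (X + C (r j))).degree = ((Finset.univ : Finset ι).card : WithBot ℕ) := by
      simp [degree_prod, -Finset.card_univ]
    have d2 : (∏ j, (X - C (a j))).degree = ((Finset.univ : Finset ι).card : WithBot ℕ) := by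
      simp [degree_prod, -Finset.card_univ]
    rw [hsplit]
    refine Submodule.sub_mem _ (Submodule.smul_mem _ _ ?_)
      (Submodule.sum_mem _ fun i _ => Submodule.smul_mem _ _ ?_)
    · rw [mem_degreeLT, ← d1]
      exact degree_sub_lt_left (d1.trans d2.symm) h1.ne_zero (h1.leadingCoeff.trans h2.leadingCoeff.symm)
    · rw [mem_degreeLT]
      have : (∏ j ∈ Finset.univ.erase i, (X + C (r j))).degree =
          ((Finset.univ.erase i).card : WithBot ℕ) := by
        simp [degree_prod]
      rw [this]
      exact_mod_cast Finset.card_erase_lt_of_mem (Finset.mem_univ i)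
  rw [mem_degreeLT] at hdeg
  rw [← sub_eq_zero]
  refine eq_zero_of_degree_lt_of_eval_index_eq_zero Finset.univ ha.injOn hdeg fun i _ => ?_
  rw [eval_sub, hroot, eval_mul, eval_prod,
    Finset.prod_eq_zero (Finset.mem_univ i) (by simp)]
  simp

/-- `P` changes sign between `-r_k` and `-r_i` when no other `-r_j` lies between them. -/
lemma eval_secularPoly_neg_mul_neg (hb : ∀ i, 0 < b i) {i k : ι} (hik : r i < r k)
    (hbetween : ∀ j, j ≠ i → j ≠ k → r j < r i ∨ r k < r j) :
    (secularPoly D b r).eval (-r k) * (secularPoly D b r).eval (-r i) < 0 := by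
  have hne : i ≠ k := fun h => hik.ne (congrArg r h)
  have hk : k ∈ Finset.univ.erase i := by simpa using hne.symm
  have hi : i ∈ Finset.univ.erase k := by simpa using hne
  have hpos : 0 < (∏ j ∈ (Finset.univ.erase i).erase k, (r j - r i)) *
      ∏ j ∈ (Finset.univ.erase i).erase k, (r j - r k) := by
    rw [← Finset.prod_mul_distrib]
    refine Finset.prod_pos fun j hj => ?_
    simp only [Finset.mem_erase, Finset.mem_univ, and_true] at hj
    rcases hbetween j hj.2 hj.1 with h | h
    · exact mul_pos_of_neg_of_neg (by linarith) (by linarith)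
    · exact mul_pos (by linarith) (by linarith)
  rw [eval_secularPoly_neg, eval_secularPoly_neg, ← Finset.mul_prod_erase _ _ hk,
    ← Finset.mul_prod_erase _ _ hi, Finset.erase_right_comm (a := k)]
  have := mul_pos (mul_pos (mul_pos (hb i) (hb k)) (pow_pos (sub_pos.2 hik) 2)) hpos
  linear_combination this

/-- `P` is nonnegative at `x` when every `x + r_i` is at least `N B / D`. -/
lemma eval_secularPoly_nonneg [Nonempty ι] (hD : 0 < D) {B x : ℝ} (hB : 0 < B)
    (hbB : ∀ i, b i ≤ B) (hx : ∀ i, Fintype.card ι * B / D ≤ x + r i) :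
    0 ≤ (secularPoly D b r).eval x := by
  have hN : (0 : ℝ) < Fintype.card ι := by exact_mod_cast Fintype.card_pos
  have hpos : ∀ i, 0 < x + r i := fun i => lt_of_lt_of_le (by positivity) (hx i)
  rw [eval_secularPoly, sub_nonneg]
  calc ∑ i, b i * ∏ j ∈ Finset.univ.erase i, (x + r j)
      ≤ ∑ _i : ι, D / Fintype.card ι * ∏ j, (x + r j) := by
        refine Finset.sum_le_sum fun i _ => ?_
        rw [← Finset.mul_prod_erase Finset.univ _ (Finset.mem_univ i), ← mul_assoc]
        refine mul_le_mul_of_nonneg_right ?_ (Finset.prod_nonneg fun j _ => (hpos j).le)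
        have h := hx i
        rw [div_le_iff₀ hD] at h
        rw [div_mul_eq_mul_div, le_div_iff₀ hN]
        nlinarith [hbB i]
    _ = D * ∏ j, (x + r j) := by
        rw [Finset.sum_const, Finset.card_univ, nsmul_eq_mul]
        field_simp

/-- Quantitative separation of a root from `-r_i`. -/
lemma le_abs_add_of_eval_secularPoly_eq_zero {n : ℕ} (hcard : Fintype.card ι = n + 2)
    (hD : 0 < D) (hb : ∀ i, 0 < b i) {bm B m M x : ℝ} (hbm : 0 < bm) (hbmb : ∀ i, bm ≤ b i)
    (hbB : ∀ i, b i ≤ B) (hm : 0 < m) (i e : ι) (hx : (secularPoly D b r).eval x = 0)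
    (hM : ∀ k, |x + r k| ≤ M) (hfar : ∀ k, k ≠ i → k ≠ e → m ≤ |x + r k|)
    (he : e ≠ i → 3 / 4 * m ≤ |x + r e|) :
    bm * m ^ (n + 1) / (4 * D * M ^ (n + 1) + 4 * ((n + 2 : ℕ) : ℝ) * B * M ^ n + 1) ≤
      |x + r i| := by
  have hM0 : 0 ≤ M := (abs_nonneg _).trans (hM i)
  have hB : 0 < B := (hb i).trans_le (hbB i)
  have hcardi : (Finset.univ.erase i).card = n + 1 := by
    rw [Finset.card_erase_of_mem (Finset.mem_univ i), Finset.card_univ, hcard]; rfl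
  have hlow : 3 / 4 * m * m ^ n ≤ ∏ k ∈ Finset.univ.erase i, |x + r k| :=
    Finset.mul_pow_le_prod_of_exception _ _ e (by positivity) (by linarith) hcardi
      (fun k hk hke => hfar k (Finset.ne_of_mem_erase hk) hke)
      fun hei => he (Finset.ne_of_mem_erase hei)
  have hprod : ∏ k ∈ Finset.univ.erase i, |x + r k| ≤ M ^ (n + 1) := by
    rw [← hcardi, ← Finset.prod_const]
    exact Finset.prod_le_prod (fun _ _ => abs_nonneg _) fun k _ => hM k
  have hsum : |∑ k ∈ Finset.univ.erase i,
      b k * ∏ j ∈ (Finset.univ.erase i).erase k, (x + r j)| ≤ ((n + 2 : ℕ) : ℝ) * B * M ^ n := by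
    calc _ ≤ ∑ k ∈ Finset.univ.erase i,
          |b k * ∏ j ∈ (Finset.univ.erase i).erase k, (x + r j)| := Finset.abs_sum_le_sum_abs _ _
      _ ≤ ∑ _k ∈ Finset.univ.erase i, B * M ^ n := by
        refine Finset.sum_le_sum fun k hk => ?_
        rw [abs_mul, abs_of_pos (hb k), Finset.abs_prod]
        refine mul_le_mul (hbB k) ?_ (Finset.prod_nonneg fun _ _ => abs_nonneg _) hB.le
        have hcardk : ((Finset.univ.erase i).erase k).card = n := by
          rw [Finset.card_erase_of_mem hk, hcardi]; rfl
        rw [← hcardk, ← Finset.prod_const]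
        exact Finset.prod_le_prod (fun _ _ => abs_nonneg _) fun k _ => hM k
      _ ≤ ((n + 2 : ℕ) : ℝ) * B * M ^ n := by
        rw [Finset.sum_const, hcardi, nsmul_eq_mul, mul_assoc]
        gcongr
        omega
  rw [eval_secularPoly_split _ i, sub_eq_zero] at hx
  have habs := congrArg abs hx
  rw [abs_mul, abs_mul, abs_of_pos (hb i), Finset.abs_prod] at habs
  have hfactor : |D * ∏ j ∈ Finset.univ.erase i, (x + r j) - ∑ k ∈ Finset.univ.erase i,
      b k * ∏ j ∈ (Finset.univ.erase i).erase k, (x + r j)| ≤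
      D * M ^ (n + 1) + ((n + 2 : ℕ) : ℝ) * B * M ^ n := by
    refine (abs_sub _ _).trans (add_le_add ?_ hsum)
    rw [abs_mul, abs_of_pos hD, Finset.abs_prod]
    gcongr
  rw [div_le_iff₀ (by positivity)]
  have h1 : bm * (3 / 4 * m * m ^ n) ≤ |x + r i| *
      (D * M ^ (n + 1) + ((n + 2 : ℕ) : ℝ) * B * M ^ n) := by
    calc bm * (3 / 4 * m * m ^ n) ≤ b i * ∏ k ∈ Finset.univ.erase i, |x + r k| :=
          mul_le_mul (hbmb i) hlow (by positivity) (hb i).le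
      _ ≤ _ := by
          rw [← habs]
          exact mul_le_mul_of_nonneg_left hfactor (abs_nonneg _)
  have h2 : 0 ≤ bm * m ^ (n + 1) := by positivity
  have h3 := abs_nonneg (x + r i)
  linear_combination 4 * h1 + h3 + 2 * h2

end SecularPoly

lemma StrictMono.add_le_of_lt_of_succ {N : ℕ} {r : Fin N → ℝ} (hr : StrictMono r) {m : ℝ}
    (hm : ∀ i : Fin N, ∀ h : (i : ℕ) + 1 < N, m ≤ r ⟨(i : ℕ) + 1, h⟩ - r i) {i k : Fin N}
    (hik : i < k) : r i + m ≤ r k := by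
  have h1 : (i : ℕ) + 1 < N := by omega
  have h2 : r ⟨(i : ℕ) + 1, h1⟩ ≤ r k := hr.monotone (Fin.mk_le_of_le_val (by omega))
  linarith [hm i h1]

/-- The `j`-th root lies in `(-r_j, -r_{j-1})`, and the largest one is at most `N B / D - r_0`. -/
lemma secularPoly_roots_interlace {n : ℕ} {r b a : Fin (n + 1) → ℝ} {D B : ℝ}
    (hr : StrictMono r) (hb : ∀ i, 0 < b i) (hD : 0 < D) (hbB : ∀ i, b i ≤ B)
    (ha : StrictAnti a) (hroots : ∀ x, (secularPoly D b r).eval x = 0 → ∃ j, x = a j) :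
    (∀ j, -r j < a j) ∧ (∀ i j, i < j → a j < -r i) ∧
      a 0 ≤ ((n + 1 : ℕ) : ℝ) * B / D - r 0 := by
  have hB : 0 < B := (hb 0).trans_le (hbB 0)
  have hcont : Continuous fun x => (secularPoly D b r).eval x := (secularPoly D b r).continuous
  have hnz : ∀ i, (secularPoly D b r).eval (-r i) ≠ 0 := fun i => by
    rw [eval_secularPoly_neg]
    refine neg_ne_zero.2 (mul_ne_zero (hb i).ne' (Finset.prod_ne_zero_iff.2 fun j hj => ?_))
    exact sub_ne_zero.2 (hr.injective.ne (Finset.ne_of_mem_erase hj))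
  have hex : ∀ j : Fin (n + 1), ∃ c, (secularPoly D b r).eval c = 0 ∧ -r j < c ∧
      (∀ i < j, c < -r i) ∧ (j = 0 → c ≤ ((n + 1 : ℕ) : ℝ) * B / D - r 0) := by
    intro j
    induction j using Fin.cases with
    | zero =>
      have hneg : (secularPoly D b r).eval (-r 0) < 0 := by
        rw [eval_secularPoly_neg, neg_lt_zero]
        refine mul_pos (hb 0) (Finset.prod_pos fun j hj => sub_pos.2 (hr ?_))
        exact Fin.pos_of_ne_zero (Finset.ne_of_mem_erase hj)
      have hpos : 0 ≤ (secularPoly D b r).eval (((n + 1 : ℕ) : ℝ) * B / D - r 0) := by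
        refine eval_secularPoly_nonneg hD hB hbB fun i => ?_
        rw [Fintype.card_fin]
        linarith [hr.monotone (Fin.zero_le i)]
      have hle : -r 0 ≤ ((n + 1 : ℕ) : ℝ) * B / D - r 0 := by
        have : 0 < ((n + 1 : ℕ) : ℝ) * B / D := by positivity
        linarith
      obtain ⟨c, hc, hc0⟩ := intermediate_value_Icc hle hcont.continuousOn ⟨hneg.le, hpos⟩
      refine ⟨c, hc0, lt_of_le_of_ne hc.1 ?_, fun i hi => absurd hi (Fin.not_lt_zero i),
        fun _ => hc.2⟩
      rintro rfl
      exact hnz 0 hc0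
    | succ k =>
      have hlt : r k.castSucc < r k.succ := hr Fin.castSucc_lt_succ
      have hsign := eval_secularPoly_neg_mul_neg (D := D) (r := r) hb hlt fun j h1 h2 => by
        rcases lt_or_gt_of_ne h1 with h | h
        · exact Or.inl (hr h)
        · exact Or.inr (hr (lt_of_le_of_ne (Fin.castSucc_lt_iff_succ_le.1 h) h2.symm))
      have hzero : (0 : ℝ) ∈ Set.uIcc ((secularPoly D b r).eval (-r k.succ))
          ((secularPoly D b r).eval (-r k.castSucc)) := by
        rw [Set.mem_uIcc]
        rcases mul_neg_iff.1 hsign with h | h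
        · exact Or.inr ⟨h.2.le, h.1.le⟩
        · exact Or.inl ⟨h.1.le, h.2.le⟩
      obtain ⟨c, hc, hc0⟩ := intermediate_value_uIcc hcont.continuousOn hzero
      rw [Set.uIcc_of_le (by linarith)] at hc
      refine ⟨c, hc0, lt_of_le_of_ne hc.1 ?_, fun i hi => ?_, fun h => absurd h (Fin.succ_ne_zero k)⟩
      · rintro rfl
        exact hnz _ hc0
      · have h1 : c < -r k.castSucc := lt_of_le_of_ne hc.2 (by rintro rfl; exact hnz _ hc0)
        have h2 : r i ≤ r k.castSucc := hr.monotone (Fin.le_castSucc_iff.2 hi)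
        linarith
  choose c hc0 hlo hhi htop using hex
  have hcanti : StrictAnti c := fun i j hij => (hhi j i hij).trans (hlo i)
  choose σ hσ using fun j => hroots (c j) (hc0 j)
  have hσmono : StrictMono σ := fun i j hij => by
    have := hcanti hij
    rw [hσ, hσ] at this
    exact ha.lt_iff_gt.1 this
  have hσid : ∀ j, σ j = j := fun j => le_antisymm (hσmono.le_id j) (hσmono.id_le j)
  have hca : ∀ j, a j = c j := fun j => by rw [hσ, hσid]
  simp only [hca]
  exact ⟨hlo, fun i j hij => hhi j i hij, htop 0 rfl⟩

/-- For `x` in the `j`-th interval cut out by the `-r_i`, the product of the distances to the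
other roots is bounded below. -/
lemma mul_pow_le_prod_abs_sub {n : ℕ} {r a : Fin (n + 2) → ℝ} {m μ : ℝ} (hμ : 0 ≤ μ) (hμm : μ ≤ m)
    (hm : ∀ i k, i < k → r i + m ≤ r k) (hlo : ∀ j, -r j + μ ≤ a j)
    (hhi : ∀ i j, i < j → a j ≤ -r i - μ) {x : ℝ} (j : Fin (n + 2)) (hx1 : -r j ≤ x)
    (hx2 : ∀ i < j, x ≤ -r i) :
    μ * m ^ n ≤ ∏ k ∈ Finset.univ.erase j, |x - a k| := by
  have hcard : (Finset.univ.erase j).card = n + 1 := by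
    rw [Finset.card_erase_of_mem (Finset.mem_univ j), Finset.card_fin]; rfl
  have hm0 : 0 ≤ m := hμ.trans hμm
  have habove : ∀ k, j < k → x + r j + μ ≤ |x - a k| := fun k hk =>
    le_trans (by linarith [hhi j k hk]) (le_abs_self _)
  have habove_far : ∀ i k, j < i → i < k → m ≤ |x - a k| := fun i k hji hik =>
    le_trans (by linarith [hhi i k hik, hm j i hji]) (le_abs_self _)
  have hbelow : ∀ k, k < j → -r k - x + μ ≤ |x - a k| := fun k hk =>
    le_trans (by linarith [hlo k]) (neg_le_abs _)
  have hbelow_far : ∀ i k, i < j → k < i → m ≤ |x - a k| := fun i k hij hki =>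
    le_trans (by linarith [hlo k, hm k i hki, hx2 i hij]) (neg_le_abs _)
  by_cases hj : j = 0
  · subst hj
    refine Finset.mul_pow_le_prod_of_exception _ _ 1 hμ hμm hcard (fun k hk hk1 => ?_) fun _ => ?_
    · have hk0 : k ≠ 0 := Finset.ne_of_mem_erase hk
      refine habove_far 1 k Fin.zero_lt_one ?_
      rw [ne_eq, Fin.ext_iff, Fin.val_zero] at hk0
      rw [ne_eq, Fin.ext_iff, Fin.val_one] at hk1
      rw [Fin.lt_def, Fin.val_one]
      omega
    · linarith [habove 1 Fin.zero_lt_one]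
  · obtain ⟨p, rfl⟩ := Fin.exists_succ_eq.2 hj
    have hpj : p.castSucc < p.succ := Fin.castSucc_lt_succ
    have hp : p.castSucc ∈ Finset.univ.erase p.succ := by simpa using hpj.ne
    have hcardp : ((Finset.univ.erase p.succ).erase p.castSucc).card = n := by
      rw [Finset.card_erase_of_mem hp, hcard]; rfl
    rw [← Finset.mul_prod_erase _ _ hp]
    have ht := hbelow _ hpj
    have ht0 := hx2 _ hpj
    have hfar : ∀ k ∈ (Finset.univ.erase p.succ).erase p.castSucc, (k : ℕ) ≠ p + 2 →
        m ≤ |x - a k| := by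
      intro k hk hkp
      simp only [Finset.mem_erase, Finset.mem_univ, and_true, ne_eq, Fin.ext_iff,
        Fin.val_castSucc, Fin.val_succ] at hk
      rcases lt_or_ge (k : ℕ) p with h | h
      · exact hbelow_far p.castSucc k hpj h
      · have hk3 : (p : ℕ) + 2 < k := by omega
        refine habove_far ⟨p + 2, by omega⟩ k ?_ hk3
        rw [Fin.lt_def]
        simp
    by_cases hlast : (p : ℕ) + 2 < n + 2
    · have hn : n = (n - 1) + 1 := by omega
      have hq : p.succ < (⟨p + 2, hlast⟩ : Fin (n + 2)) := by
        rw [Fin.lt_def]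
        simp
      have hs := habove _ hq
      have hgap := hm _ _ hpj
      have h1 : min (x + r p.succ + μ) m * m ^ (n - 1) ≤
          ∏ k ∈ (Finset.univ.erase p.succ).erase p.castSucc, |x - a k| :=
        Finset.mul_pow_le_prod_of_exception _ _ ⟨p + 2, hlast⟩ (le_min (by linarith) hm0)
          (min_le_right _ _) (hcardp.trans hn)
          (fun k hk hke => hfar k hk fun h => hke (Fin.ext h))
          fun _ => (min_le_left _ _).trans hs
      have h2 : μ * m ≤ (-r p.castSucc - x + μ) * min (x + r p.succ + μ) m := by
        rcases min_choice (x + r p.succ + μ) m with h | h <;> rw [h]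
        · nlinarith [mul_nonneg (sub_nonneg.2 ht0) (neg_le_iff_add_nonneg.1 hx1)]
        · exact mul_le_mul_of_nonneg_right (by linarith) hm0
      calc μ * m ^ n = μ * m * m ^ (n - 1) := by
            rw [mul_assoc, ← pow_succ', ← hn]
        _ ≤ (-r p.castSucc - x + μ) * min (x + r p.succ + μ) m * m ^ (n - 1) := by gcongr
        _ = (-r p.castSucc - x + μ) * (min (x + r p.succ + μ) m * m ^ (n - 1)) := by ring
        _ ≤ _ := mul_le_mul ht h1
            (mul_nonneg (le_min (by linarith) hm0) (by positivity)) (abs_nonneg _)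
    · have h1 : m ^ n ≤ ∏ k ∈ (Finset.univ.erase p.succ).erase p.castSucc, |x - a k| := by
        refine ((Finset.prod_const m).trans (congrArg _ hcardp)).ge.trans ?_
        exact Finset.prod_le_prod (fun _ _ => hm0) fun k hk => hfar k hk (by omega)
      exact mul_le_mul (by linarith) h1 (by positivity) (abs_nonneg _)

/-- Lower bound for the derivative of a split polynomial near one of its roots. -/
lemma le_abs_eval_derivative_prod {ι : Type*} [Fintype ι] [DecidableEq ι] {n : ℕ}
    (hcard : Fintype.card ι = n + 2) {D R δ x L : ℝ} (hD : 0 < D) (a : ι → ℝ) (j : ι)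
    (hx : |x - a j| ≤ δ) (hR : ∀ k, |x - a k| ≤ R)
    (hL : L ≤ ∏ k ∈ Finset.univ.erase j, |x - a k|) :
    D * (L - δ * ((n + 2 : ℕ) * R ^ n)) ≤
      |(derivative (C D * ∏ k, (X - C (a k)))).eval x| := by
  have hR0 : 0 ≤ R := (abs_nonneg _).trans (hR j)
  have hcardj : (Finset.univ.erase j).card = n + 1 := by
    rw [Finset.card_erase_of_mem (Finset.mem_univ j), Finset.card_univ, hcard]; rfl
  have hder : (derivative (C D * ∏ k, (X - C (a k)))).eval x =
      D * (∏ k ∈ Finset.univ.erase j, (x - a k) + (x - a j) *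
        ∑ k ∈ Finset.univ.erase j, ∏ l ∈ (Finset.univ.erase j).erase k, (x - a l)) := by
    rw [← Finset.mul_prod_erase Finset.univ _ (Finset.mem_univ j)]
    simp only [derivative_mul, derivative_C, zero_mul, zero_add, derivative_sub, derivative_X,
      sub_zero, one_mul, derivative_prod_finset, mul_one, eval_mul, eval_add, eval_C, eval_sub, eval_X,
      eval_prod, eval_finsetSum]
  have hsum : |∑ k ∈ Finset.univ.erase j, ∏ l ∈ (Finset.univ.erase j).erase k, (x - a l)| ≤
      (n + 2 : ℕ) * R ^ n := by
    calc _ ≤ ∑ k ∈ Finset.univ.erase j, |∏ l ∈ (Finset.univ.erase j).erase k, (x - a l)| :=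
          Finset.abs_sum_le_sum_abs _ _
      _ ≤ ∑ _k ∈ Finset.univ.erase j, R ^ n := by
        refine Finset.sum_le_sum fun k hk => ?_
        have hcardk : ((Finset.univ.erase j).erase k).card = n := by
          rw [Finset.card_erase_of_mem hk, hcardj]; rfl
        rw [Finset.abs_prod, ← hcardk, ← Finset.prod_const]
        exact Finset.prod_le_prod (fun _ _ => abs_nonneg _) fun l _ => hR l
      _ ≤ (n + 2 : ℕ) * R ^ n := by
        rw [Finset.sum_const, hcardj, nsmul_eq_mul]
        gcongr
        omega
  have hsecond := mul_le_mul hx hsum (abs_nonneg _) ((abs_nonneg _).trans hx)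
  rw [← abs_mul] at hsecond
  rw [hder, abs_mul, abs_of_pos hD]
  rw [← Finset.abs_prod] at hL
  refine mul_le_mul_of_nonneg_left ?_ hD.le
  have := abs_sub_abs_le_abs_sub (∏ k ∈ Finset.univ.erase j, (x - a k)) (-((x - a j) *
        ∑ k ∈ Finset.univ.erase j, ∏ l ∈ (Finset.univ.erase j).erase k, (x - a l)))
  rw [abs_neg, sub_neg_eq_add] at this
  linarith

/-- With `bm := min b_i`, `B := max b_i`, `rm := min (r_{i+1} - r_i)`,
`μ := min { bm·rm^(N-1) / (4D(2r_N)^(N-1) + 4NB(2r_N)^(N-2) + 1), rm/4, r_1/4 }`,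
`R := 2r_N + NB/D + 1` and `δ := rm^(N-2)·μ / (2N·R^(N-2))`, and `a_1 > ⋯ > a_N` the `N`
real roots of `P_N`, one has: (i) `|P_N'(λ)| ≥ D·μ·rm^(N-2)/2` on the union of the
intervals `[a_j - δ, a_j + δ]`; and (ii) `|P_N(λ)| ≥ D·μ·δ·rm^(N-2)` on
`[-r_N, a_1 + 1]` outside that union. -/
theorem stmt_14 (N : ℕ) (hN : 2 ≤ N) (r b : Fin N → ℝ)
    (hr : ∀ i, 0 < r i) (hrmono : StrictMono r) (hb : ∀ i, 0 < b i)
    (D : ℝ) (hD : 0 < D)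
    (P : Polynomial ℝ)
    (hP : P = C D * ∏ j, (X + C (r j)) -
      ∑ i, C (b i) * ∏ j ∈ Finset.univ.erase i, (X + C (r j)))
    (a : Fin N → ℝ) (haanti : StrictAnti a)
    (haroots : ∀ x : ℝ, P.eval x = 0 ↔ ∃ j, x = a j)
    (bm B rm μ R δ : ℝ)
    (hbm : bm = Finset.univ.inf' ⟨⟨0, by omega⟩, Finset.mem_univ _⟩ b)
    (hB : B = Finset.univ.sup' ⟨⟨0, by omega⟩, Finset.mem_univ _⟩ b)
    (hrm_le : ∀ i : Fin N, ∀ h : (i : ℕ) + 1 < N, rm ≤ r ⟨(i : ℕ) + 1, h⟩ - r i)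
    (hrm_mem : ∃ i : Fin N, ∃ h : (i : ℕ) + 1 < N, rm = r ⟨(i : ℕ) + 1, h⟩ - r i)
    (hμ : μ = min (min
      (bm * rm ^ (N - 1) /
        (4 * D * (2 * r ⟨N - 1, by omega⟩) ^ (N - 1) +
          4 * (N : ℝ) * B * (2 * r ⟨N - 1, by omega⟩) ^ (N - 2) + 1))
      (rm / 4)) (r ⟨0, by omega⟩ / 4))
    (hR : R = 2 * r ⟨N - 1, by omega⟩ + (N : ℝ) * B / D + 1)
    (hδ : δ = rm ^ (N - 2) * μ / (2 * (N : ℝ) * R ^ (N - 2))) :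
    (∀ j : Fin N, ∀ x : ℝ, x ∈ Set.Icc (a j - δ) (a j + δ) →
      D * μ * rm ^ (N - 2) / 2 ≤ |(Polynomial.derivative P).eval x|) ∧
    (∀ x : ℝ, x ∈ Set.Icc (-(r ⟨N - 1, by omega⟩)) (a ⟨0, by omega⟩ + 1) →
      (∀ j : Fin N, x ∉ Set.Icc (a j - δ) (a j + δ)) →
      D * μ * δ * rm ^ (N - 2) ≤ |P.eval x|) := by
  obtain ⟨n, rfl⟩ := Nat.exists_eq_add_of_le' hN
  have h0 : (⟨0, by omega⟩ : Fin (n + 2)) = 0 := rfl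
  have hl : (⟨n + 2 - 1, by omega⟩ : Fin (n + 2)) = Fin.last (n + 1) := rfl
  rw [h0] at hμ ⊢
  rw [hl] at hμ hR ⊢
  rw [show n + 2 - 1 = n + 1 from rfl, Nat.add_sub_cancel] at hμ
  rw [Nat.add_sub_cancel] at hδ ⊢
  obtain rfl : P = secularPoly D b r := hP
  have hbmb : ∀ i, bm ≤ b i := fun i => hbm ▸ Finset.inf'_le _ (Finset.mem_univ i)
  have hbB : ∀ i, b i ≤ B := fun i => hB ▸ Finset.le_sup' _ (Finset.mem_univ i)
  have hbm0 : 0 < bm := by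
    rw [hbm]
    exact (Finset.lt_inf'_iff _).2 fun i _ => hb i
  have hB0 : 0 < B := (hb 0).trans_le (hbB 0)
  have hrm0 : 0 < rm := by
    obtain ⟨i, h, rfl⟩ := hrm_mem
    exact sub_pos.2 (hrmono (Fin.lt_def.2 (Nat.lt_succ_self _)))
  have hgap : ∀ i k, i < k → r i + rm ≤ r k := fun i k => hrmono.add_le_of_lt_of_succ hrm_le
  have hlast : ∀ i, r i ≤ r (Fin.last (n + 1)) := fun i => hrmono.monotone (Fin.le_last i)
  have hr0 := hr 0
  have hrl := hr (Fin.last (n + 1))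
  have hμ1 : μ ≤ rm / 4 := hμ ▸ (min_le_left _ _).trans (min_le_right _ _)
  have hμ2 : μ ≤ r 0 / 4 := hμ ▸ min_le_right _ _
  have hμ0 : 0 < μ := by
    rw [hμ]
    refine lt_min (lt_min ?_ (by positivity)) (by positivity)
    positivity
  obtain ⟨hlo, hhi, htop⟩ := secularPoly_roots_interlace hrmono hb hD hbB haanti
    fun x hx => (haroots x).1 hx
  have hroot : ∀ j, (secularPoly D b r).eval (a j) = 0 := fun j => (haroots _).2 ⟨j, rfl⟩
  have hsep : ∀ i e j, (∀ k, k ≠ i → k ≠ e → rm ≤ |a j + r k|) → μ ≤ |a j + r i| := by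
    intro i e j hfar
    by_contra! hlt
    have hlt' := abs_lt.1 hlt
    have hri : r 0 ≤ r i := hrmono.monotone (Fin.zero_le i)
    refine hlt.not_ge (le_trans ?_ (le_abs_add_of_eval_secularPoly_eq_zero
      (M := 2 * r (Fin.last (n + 1))) (Fintype.card_fin _) hD hb hbm0 hbmb hbB hrm0 i e
      (hroot j) (fun k => ?_) hfar fun hei => ?_))
    · exact hμ ▸ (min_le_left _ _).trans (min_le_left _ _)
    · rw [abs_le]
      constructor <;> linarith [hlast k, hr k, hlast j, hlo j]
    · rcases lt_or_gt_of_ne hei with h | h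
      · exact le_trans (by linarith [hgap _ _ h]) (neg_le_abs _)
      · exact le_trans (by linarith [hgap _ _ h]) (le_abs_self _)
  have hfar1 : ∀ j k, j < k → rm ≤ |a j + r k| := fun j k h =>
    le_trans (by linarith [hgap _ _ h, hlo j]) (le_abs_self _)
  have hfar2 : ∀ i j k, i < j → k < i → rm ≤ |a j + r k| := fun i j k hij hki =>
    le_trans (by linarith [hgap _ _ hki, hhi _ _ hij]) (neg_le_abs _)
  have hlo' : ∀ j, -r j + μ ≤ a j := by
    intro j
    have h : μ ≤ |a j + r j| := by
      induction j using Fin.cases with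
      | zero => exact hsep 0 0 0 fun k hk _ => hfar1 0 k (Fin.pos_of_ne_zero hk)
      | succ p =>
        refine hsep p.succ p.castSucc p.succ fun k h1 h2 => ?_
        rcases lt_or_gt_of_ne h1 with h | h
        · exact hfar2 p.castSucc _ k Fin.castSucc_lt_succ
            (lt_of_le_of_ne (Fin.le_castSucc_iff.2 h) h2)
        · exact hfar1 _ _ h
    rw [abs_of_pos (by linarith [hlo j])] at h
    linarith
  have hhi' : ∀ i j, i < j → a j ≤ -r i - μ := by
    intro i j hij
    obtain ⟨p, rfl⟩ := Fin.exists_succ_eq.2 (Fin.ne_zero_of_lt hij)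
    have hp : p.castSucc < p.succ := Fin.castSucc_lt_succ
    have h : μ ≤ |a p.succ + r p.castSucc| := by
      refine hsep p.castSucc p.succ p.succ fun k h1 h2 => ?_
      rcases lt_or_gt_of_ne h2 with h | h
      · exact hfar2 p.castSucc _ k hp (lt_of_le_of_ne (Fin.le_castSucc_iff.2 h) h1)
      · exact hfar1 _ _ h
    rw [abs_of_neg (by linarith [hhi _ _ hp])] at h
    linarith [hrmono.monotone (Fin.le_castSucc_iff.2 hij)]
  have hlower := fun {x : ℝ} => mul_pow_le_prod_abs_sub (x := x) hμ0.le
    (by linarith : μ ≤ rm) hgap hlo' hhi'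
  have hNBD : 0 < ((n + 2 : ℕ) : ℝ) * B / D := by positivity
  have hrmR : rm ≤ R := by
    linarith [hgap 0 1 Fin.zero_lt_one, hlast 1]
  have hR0 : 0 < R := hrm0.trans_le hrmR
  have hδR : δ * (((n + 2 : ℕ) : ℝ) * R ^ n) = rm ^ n * μ / 2 := by
    rw [hδ]
    field_simp
  have hδ0 : 0 < δ := by rw [hδ]; positivity
  have hδμ : δ ≤ μ := by
    rw [hδ, div_le_iff₀ (by positivity)]
    have h1 : rm ^ n ≤ R ^ n := by gcongr
    have h2 : (1 : ℝ) ≤ 2 * ((n + 2 : ℕ) : ℝ) := by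
      push_cast
      linarith [(Nat.cast_nonneg n : (0 : ℝ) ≤ n)]
    calc rm ^ n * μ ≤ R ^ n * μ := by gcongr
      _ ≤ 2 * ((n + 2 : ℕ) : ℝ) * (R ^ n * μ) := le_mul_of_one_le_left (by positivity) h2
      _ = _ := by ring
  rw [secularPoly_eq_prod haanti.injective hroot]
  refine ⟨fun j x hx => ?_, fun x hx hxa => ?_⟩
  · have hL := hlower (x := x) j (by linarith [hx.1, hlo' j])
      fun i hi => by linarith [hx.2, hhi' i j hi]
    have hmain := le_abs_eval_derivative_prod (δ := δ) (R := R) (Fintype.card_fin (n + 2)) hD a j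
      (abs_le.2 ⟨by linarith [hx.1], by linarith [hx.2]⟩) (fun k => ?_) hL
    · rw [hδR] at hmain
      linear_combination hmain
    · have hj := haanti.antitone (Fin.zero_le j)
      have hk := haanti.antitone (Fin.zero_le k)
      rw [abs_le]
      constructor <;> linarith [hx.1, hx.2, hlo j, hlo k, hlast j, hlast k]
  · have hne : (Finset.univ.filter fun j => -r j ≤ x).Nonempty :=
      ⟨Fin.last (n + 1), by simpa using hx.1⟩
    obtain ⟨j, hj, hmin⟩ := Finset.exists_min_image _ id hne
    simp only [Finset.mem_filter, Finset.mem_univ, true_and, id] at hj hmin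
    have hL := hlower (x := x) j hj fun i hi => by
      by_contra! h
      exact (hmin i h.le).not_gt hi
    have hdist : δ ≤ |x - a j| := by
      by_contra! h
      have h' := abs_lt.1 h
      exact hxa j ⟨by linarith, by linarith⟩
    simp only [eval_mul, eval_C, eval_prod, eval_sub, eval_X]
    rw [← Finset.mul_prod_erase Finset.univ _ (Finset.mem_univ j), abs_mul, abs_mul,
      abs_of_pos hD, Finset.abs_prod]
    calc D * μ * δ * rm ^ n = D * (δ * (μ * rm ^ n)) := by ring
      _ ≤ _ := mul_le_mul_of_nonneg_left
          (mul_le_mul hdist hL (by positivity) (abs_nonneg _)) hD.le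
end
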